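/- For every i ∈ {0,…,k}, the random variable D^{(i)} := k−i+1 + T_i + Σ_{m=i+1}^{k} Σ_{j=1}^{T_m} N_{i,j}^{(m)} (from the compound negative-binomial construction, with the parameter z integrated over the Pareto law with density (τ/b_0) z^{−(1+τ/b_0)}, z ≥ 1) has the mixed negative binomial law: for every ℓ ∈ {0,1,2,…}, P(D^{(i)} = k−i+1+ℓ) = ∫_1^∞ (τ/b_0) z^{−(1+τ/b_0)} p^NB_{(k−i+1)(1+δ)/b_i, z^{−b_i/b_0}}(ℓ) dz. -/

import Mathlib

open MeasureTheory Filter Finset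

noncomputable section

/-- The coefficient `b_m = k - m + 1 + δ(k - m)`. -/
def bcoef (k : ℕ) (δ : ℝ) (m : ℕ) : ℝ := (k : ℝ) - m + 1 + δ * ((k : ℝ) - m)

/-- The coefficient `τ = k + 2 + δ(k + 1)`. -/
def tauc (k : ℕ) (δ : ℝ) : ℝ := (k : ℝ) + 2 + δ * ((k : ℝ) + 1)

/-- The negative binomial pmf with shape `r` and success probability `a`. -/
def nbWeight (r a : ℝ) (ℓ : ℕ) : ℝ :=
  Real.Gamma ((ℓ : ℝ) + r) / ((ℓ.factorial : ℝ) * Real.Gamma r) * (1 - a) ^ ℓ * a ^ r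

/-- The extended truncated negative binomial pmf with parameters `κ` and `a`. -/
def tnbWeight (κ a : ℝ) (ℓ : ℕ) : ℝ :=
  if ℓ = 0 then 0
  else κ * Real.Gamma ((ℓ : ℝ) - κ) / ((ℓ.factorial : ℝ) * Real.Gamma (1 - κ))
    * (1 - a) ^ ℓ / (1 - a ^ κ)

/-- The measure on `ℕ` with mass function `f`. -/
def natMeasure (f : ℕ → ℝ) : Measure ℕ :=
  Measure.sum fun ℓ => ENNReal.ofReal (f ℓ) • Measure.dirac ℓ

/-- `ℓ`-fold convolution power of a measure on `Fin m → ℕ`, i.e. the law of a sum of `ℓ`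
i.i.d. vectors of law `ν`. -/
def convPow {m : ℕ} (ν : Measure (Fin m → ℕ)) : ℕ → Measure (Fin m → ℕ)
  | 0 => Measure.dirac 0
  | ℓ + 1 => (ν.prod (convPow ν ℓ)).map fun p => p.1 + p.2

/-- The law of the random vector `(N_0^{(m)}, …, N_{m-1}^{(m)})` from the compound
negative-binomial construction with parameter `z`: the last coordinate `N_{m-1}^{(m)}` is
extended truncated negative binomial with parameters `b_m / b_{m-1}` and `z^{-b_{m-1}/b_0}`,
and conditionally on `N_{m-1}^{(m)} = ℓ` the first `m - 1` coordinates form the sum of `ℓ`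
i.i.d. copies of `(N_0^{(m-1)}, …, N_{m-2}^{(m-1)})`. -/
def vecLaw (k : ℕ) (δ : ℝ) (z : ℝ) : (m : ℕ) → Measure (Fin m → ℕ)
  | 0 => Measure.dirac 0
  | m + 1 =>
    (natMeasure (tnbWeight (bcoef k δ (m + 1) / bcoef k δ m)
        (z ^ (-(bcoef k δ m / bcoef k δ 0))))).bind
      fun ℓ => (convPow (vecLaw k δ z m) ℓ).map fun v => Fin.snoc v ℓ

/-- The joint law of `(T_m, Σ_{j=1}^{T_m} (N_{0,j}^{(m)}, …, N_{m-1,j}^{(m)}))`, where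
`T_m` is negative binomial with shape `(1+δ)/b_m` and success probability `z^{-b_m/b_0}`,
and the summands are i.i.d. copies of `(N_0^{(m)}, …, N_{m-1}^{(m)})` independent of `T_m`. -/
def pairLaw (k : ℕ) (δ : ℝ) (z : ℝ) (m : ℕ) : Measure (ℕ × (Fin m → ℕ)) :=
  (natMeasure (nbWeight ((1 + δ) / bcoef k δ m) (z ^ (-(bcoef k δ m / bcoef k δ 0))))).bind
    fun t => (convPow (vecLaw k δ z m) t).map fun v => (t, v)

/-- The joint law of the independent family
`((T_m, Σ_{j=1}^{T_m} N_{·,j}^{(m)}))_{m = 0, …, k}` given `z`. -/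
def jointLaw (k : ℕ) (δ : ℝ) (z : ℝ) :
    Measure (∀ m : Fin (k + 1), ℕ × (Fin (m : ℕ) → ℕ)) :=
  Measure.pi fun m => pairLaw k δ z (m : ℕ)

/-- Assembles the degree vector: coordinate `i` is
`k - i + 1 + T_i + Σ_{m=i+1}^{k} Σ_{j=1}^{T_m} N_{i,j}^{(m)}`. -/
def assembleD (k : ℕ) (x : ∀ m : Fin (k + 1), ℕ × (Fin (m : ℕ) → ℕ)) : Fin (k + 1) → ℕ :=
  fun i => (k - (i : ℕ) + 1) + (x i).1 +
    ∑ m : Fin (k + 1), if h : (i : ℕ) < (m : ℕ) then (x m).2 ⟨(i : ℕ), h⟩ else 0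

/-- Given `z`, the conditional law of the random degree vector
`(k - i + 1 + T_i + Σ_{m=i+1}^{k} Σ_{j=1}^{T_m} N_{i,j}^{(m)})_{i = 0, …, k}`. -/
def Dlaw (k : ℕ) (δ : ℝ) (z : ℝ) : Measure (Fin (k + 1) → ℕ) :=
  (jointLaw k δ z).map (assembleD k)

theorem gamma_natCast_add {r : ℝ} (hr : ∀ n : ℕ, r ≠ -n) (n : ℕ) :
    Real.Gamma ((n : ℝ) + r) = (ascPochhammer ℝ n).eval r * Real.Gamma r := by
  induction n with
  | zero => simp
  | succ n ih =>
    have h : (n : ℝ) + r ≠ 0 := fun h => hr n (by linarith)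
    rw [ascPochhammer_succ_eval, Nat.cast_succ, add_right_comm, Real.Gamma_add_one h, ih]
    ring

theorem hasSum_Gamma_mul_pow {r : ℝ} (hr : ∀ n : ℕ, r ≠ -n) {x : ℝ} (hx : |x| < 1) :
    HasSum (fun n : ℕ => Real.Gamma ((n : ℝ) + r) / ((n.factorial : ℝ) * Real.Gamma r) * x ^ n)
      ((1 - x) ^ (-r)) := by
  have hG : Real.Gamma r ≠ 0 := Real.Gamma_ne_zero hr
  have h := (Real.one_div_one_sub_rpow_hasFPowerSeriesOnBall_zero r).hasSum (y := x)
    (by simpa [enorm_eq_nnnorm] using! hx)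
  rw [zero_add, one_div, ← Real.rpow_neg (by linarith [(abs_lt.1 hx).2])] at h
  refine h.congr_fun fun n => ?_
  have hc : (n.factorial : ℝ) * Ring.choose (r + n - 1) n = (ascPochhammer ℝ n).eval r := by
    rw [← Ring.multichoose_eq, ← nsmul_eq_mul, Ring.factorial_nsmul_multichoose_eq_ascPochhammer,
      Polynomial.ascPochhammer_smeval_cast, Polynomial.ascPochhammer_smeval_eq_eval]
  have hn : (n.factorial : ℝ) ≠ 0 := by positivity
  simp only [FormalMultilinearSeries.ofScalars_apply_eq, smul_eq_mul]
  rw [gamma_natCast_add hr, ← hc]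
  field_simp

theorem hasSum_nbWeight_mul_pow {r a x : ℝ} (hr : 0 < r) (ha : a ∈ Set.Ioo (0 : ℝ) 1)
    (hx : x ∈ Set.Icc (0 : ℝ) 1) :
    HasSum (fun ℓ => nbWeight r a ℓ * x ^ ℓ) (a ^ r * (1 - (1 - a) * x) ^ (-r)) := by
  obtain ⟨ha0, ha1⟩ := ha
  obtain ⟨hx0, hx1⟩ := hx
  have h := (hasSum_Gamma_mul_pow (r := r) (x := (1 - a) * x)
    (fun n => by have : (0 : ℝ) ≤ n := n.cast_nonneg
                 linarith)
    (by rw [abs_lt]; constructor <;> nlinarith)).mul_left (a ^ r)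
  refine h.congr_fun fun ℓ => ?_
  rw [nbWeight, mul_pow]
  ring

theorem hasSum_tnbWeight_mul_pow {κ a x : ℝ} (hκ : κ ∈ Set.Ioo (0 : ℝ) 1)
    (ha : a ∈ Set.Ioo (0 : ℝ) 1) (hx : x ∈ Set.Icc (0 : ℝ) 1) :
    HasSum (fun ℓ => tnbWeight κ a ℓ * x ^ ℓ) ((1 - (1 - (1 - a) * x) ^ κ) / (1 - a ^ κ)) := by
  obtain ⟨ha0, ha1⟩ := ha
  obtain ⟨hx0, hx1⟩ := hx
  obtain ⟨hκ0, hκ1⟩ := hκ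
  have hne : ∀ n : ℕ, -κ ≠ -n := by
    rintro (_ | n) h
    · simp at h; linarith
    · push_cast at h
      have : (0 : ℝ) ≤ n := n.cast_nonneg
      linarith
  have h := hasSum_Gamma_mul_pow (r := -κ) (x := (1 - a) * x) hne
    (by rw [abs_lt]; constructor <;> nlinarith)
  have hG : Real.Gamma (-κ) ≠ 0 := Real.Gamma_ne_zero hne
  have hG1 : Real.Gamma (1 - κ) = -κ * Real.Gamma (-κ) := by
    rw [← Real.Gamma_add_one (by linarith)]; ring_nf
  have h2 := ((hasSum_ite_eq (0 : ℕ) (1 : ℝ)).sub h).div_const (1 - a ^ κ)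
  rw [neg_neg] at h2
  refine h2.congr_fun fun ℓ => ?_
  rw [tnbWeight]
  split_ifs with hℓ
  · subst hℓ; simp [hG]
  · rw [hG1, mul_pow, ← sub_eq_add_neg]
    have : (ℓ.factorial : ℝ) ≠ 0 := by positivity
    field_simp
    ring

theorem nbWeight_nonneg {r a : ℝ} (hr : 0 < r) (ha : a ∈ Set.Ioo (0 : ℝ) 1) (ℓ : ℕ) :
    0 ≤ nbWeight r a ℓ := by
  have h1 : 0 ≤ 1 - a := by linarith [ha.2]
  have h2 := ha.1.le
  have h3 := Real.Gamma_pos_of_pos hr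
  have h4 : 0 < Real.Gamma ((ℓ : ℝ) + r) := Real.Gamma_pos_of_pos (by positivity)
  unfold nbWeight
  positivity

theorem tnbWeight_nonneg {κ a : ℝ} (hκ : κ ∈ Set.Ioo (0 : ℝ) 1) (ha : a ∈ Set.Ioo (0 : ℝ) 1)
    (ℓ : ℕ) : 0 ≤ tnbWeight κ a ℓ := by
  unfold tnbWeight
  split_ifs with hℓ
  · rfl
  have h1 : 0 ≤ 1 - a := by linarith [ha.2]
  have h2 : 0 ≤ 1 - a ^ κ := by linarith [Real.rpow_lt_one ha.1.le ha.2 hκ.1]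
  have h3 : 0 < Real.Gamma (1 - κ) := Real.Gamma_pos_of_pos (by linarith [hκ.2])
  have hℓ1 : (1 : ℝ) ≤ ℓ := by exact_mod_cast Nat.one_le_iff_ne_zero.2 hℓ
  have h4 : 0 < Real.Gamma ((ℓ : ℝ) - κ) := Real.Gamma_pos_of_pos (by linarith [hκ.2])
  have h5 := hκ.1
  positivity

open scoped ENNReal in
theorem lintegral_natMeasure (f : ℕ → ℝ) (g : ℕ → ℝ≥0∞) :
    ∫⁻ ℓ, g ℓ ∂natMeasure f = ∑' ℓ, ENNReal.ofReal (f ℓ) * g ℓ := by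
  simp [natMeasure, lintegral_sum_measure]

theorem natMeasure_singleton (f : ℕ → ℝ) (ℓ : ℕ) :
    natMeasure f {ℓ} = ENNReal.ofReal (f ℓ) := by
  rw [← lintegral_indicator_one (measurableSet_singleton ℓ), lintegral_natMeasure,
    tsum_eq_single ℓ]
  · simp
  · intro b hb
    simp [hb]

theorem lintegral_pow_natMeasure {f : ℕ → ℝ} (hf : ∀ ℓ, 0 ≤ f ℓ) {x S : ℝ} (hx : 0 ≤ x)
    (h : HasSum (fun ℓ => f ℓ * x ^ ℓ) S) :
    ∫⁻ ℓ, ENNReal.ofReal x ^ ℓ ∂natMeasure f = ENNReal.ofReal S := by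
  rw [lintegral_natMeasure, ← h.tsum_eq,
    ENNReal.ofReal_tsum_of_nonneg (fun ℓ => mul_nonneg (hf ℓ) (pow_nonneg hx ℓ)) h.summable]
  simp [ENNReal.ofReal_mul (hf _), ENNReal.ofReal_pow hx]

theorem isProbabilityMeasure_natMeasure {f : ℕ → ℝ} (hf : ∀ ℓ, 0 ≤ f ℓ) (h : HasSum f 1) :
    IsProbabilityMeasure (natMeasure f) := by
  refine ⟨?_⟩
  simpa using lintegral_pow_natMeasure hf zero_le_one (S := 1) (by simpa using h)

theorem hasFPowerSeriesAt_tsum_measure (μ : Measure ℕ) [IsProbabilityMeasure μ] :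
    HasFPowerSeriesAt (fun x : ℝ => ∑' n, μ.real {n} * x ^ n)
      (FormalMultilinearSeries.ofScalars ℝ fun n => μ.real {n}) 0 := by
  have hr : 0 < (FormalMultilinearSeries.ofScalars ℝ fun n => μ.real {n}).radius := by
    refine lt_of_lt_of_le (by simp) (FormalMultilinearSeries.le_radius_of_bound _ 1 (r := 1) ?_)
    intro n
    simp [abs_of_nonneg]
  have h := (FormalMultilinearSeries.hasFPowerSeriesOnBall _ hr).hasFPowerSeriesAt
  have he : (FormalMultilinearSeries.ofScalars ℝ fun n => μ.real {n}).sum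
      = fun x : ℝ => ∑' n, μ.real {n} * x ^ n := by
    funext x
    exact (FormalMultilinearSeries.ofScalars_sum_eq (E := ℝ) _ x).trans (by simp only [smul_eq_mul])
  rwa [he] at h

theorem toReal_lintegral_pow (μ : Measure ℕ) [IsProbabilityMeasure μ] {x : ℝ} (hx : 0 ≤ x) :
    (∫⁻ n, ENNReal.ofReal x ^ n ∂μ).toReal = ∑' n, μ.real {n} * x ^ n := by
  rw [lintegral_countable', ENNReal.tsum_toReal_eq]
  · simp [hx, mul_comm, Measure.real]
  · intro n
    finiteness

theorem measure_nat_ext_of_lintegral_pow {μ ν : Measure ℕ} [IsProbabilityMeasure μ]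
    [IsProbabilityMeasure ν] (h : ∀ x ∈ Set.Icc (0 : ℝ) 1,
      ∫⁻ n, ENNReal.ofReal x ^ n ∂μ = ∫⁻ n, ENNReal.ofReal x ^ n ∂ν) : μ = ν := by
  have hμ := hasFPowerSeriesAt_tsum_measure μ
  have hν := hasFPowerSeriesAt_tsum_measure ν
  have hfreq : ∃ᶠ x in nhdsWithin (0 : ℝ) {0}ᶜ,
      ∑' n, μ.real {n} * x ^ n = ∑' n, ν.real {n} * x ^ n := by
    have hev : ∀ᶠ x in nhdsWithin (0 : ℝ) (Set.Ioi 0),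
        ∑' n, μ.real {n} * x ^ n = ∑' n, ν.real {n} * x ^ n := by
      filter_upwards [Ioo_mem_nhdsGT (zero_lt_one' ℝ)] with x hx
      rw [← toReal_lintegral_pow μ hx.1.le, ← toReal_lintegral_pow ν hx.1.le,
        h x ⟨hx.1.le, hx.2.le⟩]
    exact hev.frequently.filter_mono (nhdsWithin_mono _ fun x hx => ne_of_gt hx)
  have hev := (hμ.analyticAt.frequently_eq_iff_eventually_eq hν.analyticAt).1 hfreq
  have heq := hμ.eq_formalMultilinearSeries_of_eventually hν hev
  rw [FormalMultilinearSeries.ofScalars_series_eq_iff] at heq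
  refine Measure.ext_of_singleton fun n => ?_
  exact (measureReal_eq_measureReal_iff).1 (congrFun heq n)

theorem bcoef_eq_add (k : ℕ) (δ : ℝ) (m : ℕ) : bcoef k δ m = bcoef k δ (m + 1) + (1 + δ) := by
  simp only [bcoef, Nat.cast_succ]
  ring

theorem bcoef_pos {k : ℕ} {δ : ℝ} (hδ : -1 < δ) {m : ℕ} (hm : m ≤ k) : 0 < bcoef k δ m := by
  have h : (m : ℝ) ≤ k := by exact_mod_cast hm
  unfold bcoef
  nlinarith

theorem bcoef_div_mem_Ioo {k : ℕ} {δ : ℝ} (hδ : -1 < δ) {m : ℕ} (hm : m + 1 ≤ k) :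
    bcoef k δ (m + 1) / bcoef k δ m ∈ Set.Ioo (0 : ℝ) 1 := by
  have h0 := bcoef_pos hδ hm
  have h1 := bcoef_pos hδ (Nat.le_of_succ_le hm)
  refine ⟨by positivity, (div_lt_one h1).2 ?_⟩
  rw [bcoef_eq_add k δ m]
  linarith

/-- The success probability `z^{-b_m/b_0}`. -/
def successProb (k : ℕ) (δ z : ℝ) (m : ℕ) : ℝ := z ^ (-(bcoef k δ m / bcoef k δ 0))

theorem successProb_mem_Ioo {k : ℕ} {δ : ℝ} (hδ : -1 < δ) {z : ℝ} (hz : 1 < z) {m : ℕ}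
    (hm : m ≤ k) : successProb k δ z m ∈ Set.Ioo (0 : ℝ) 1 := by
  have h0 := bcoef_pos hδ hm
  have h1 := bcoef_pos hδ k.zero_le
  exact ⟨Real.rpow_pos_of_pos (by linarith) _,
    Real.rpow_lt_one_of_one_lt_of_neg hz (neg_lt_zero.2 (by positivity))⟩

theorem successProb_rpow {k : ℕ} {δ : ℝ} (hδ : -1 < δ) {z : ℝ} (hz : 1 < z) {m : ℕ}
    (hm : m ≤ k) (c : ℝ) :
    successProb k δ z m ^ (c / bcoef k δ m) = z ^ (-(c / bcoef k δ 0)) := by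
  have h0 := bcoef_pos hδ hm
  have h1 := bcoef_pos hδ k.zero_le
  rw [successProb, ← Real.rpow_mul (by linarith)]
  congr 1
  field_simp

theorem isProbabilityMeasure_natMeasure_tnbWeight {κ a : ℝ} (hκ : κ ∈ Set.Ioo (0 : ℝ) 1)
    (ha : a ∈ Set.Ioo (0 : ℝ) 1) : IsProbabilityMeasure (natMeasure (tnbWeight κ a)) := by
  refine isProbabilityMeasure_natMeasure (tnbWeight_nonneg hκ ha) ?_
  have h : 1 - a ^ κ ≠ 0 := by linarith [Real.rpow_lt_one ha.1.le ha.2 hκ.1]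
  simpa [h] using hasSum_tnbWeight_mul_pow hκ ha (x := 1) (by simp)

theorem isProbabilityMeasure_natMeasure_nbWeight {r a : ℝ} (hr : 0 < r)
    (ha : a ∈ Set.Ioo (0 : ℝ) 1) : IsProbabilityMeasure (natMeasure (nbWeight r a)) := by
  refine isProbabilityMeasure_natMeasure (nbWeight_nonneg hr ha) ?_
  simpa [← Real.rpow_add ha.1] using hasSum_nbWeight_mul_pow hr ha (x := 1) (by simp)

instance isProbabilityMeasure_convPow {m : ℕ} (ν : Measure (Fin m → ℕ)) [IsProbabilityMeasure ν]
    (ℓ : ℕ) : IsProbabilityMeasure (convPow ν ℓ) := by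
  induction ℓ with
  | zero => unfold convPow; infer_instance
  | succ ℓ ih => exact Measure.isProbabilityMeasure_map (by fun_prop)

open scoped ENNReal in
theorem lintegral_pow_convPow {m : ℕ} (ν : Measure (Fin m → ℕ)) [IsProbabilityMeasure ν]
    (s : ℝ≥0∞) (j : Fin m) (ℓ : ℕ) :
    ∫⁻ v, s ^ v j ∂convPow ν ℓ = (∫⁻ v, s ^ v j ∂ν) ^ ℓ := by
  induction ℓ with
  | zero => simp [convPow]
  | succ ℓ ih =>
    rw [convPow, lintegral_map .of_discrete .of_discrete]
    simp only [Pi.add_apply, pow_add]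
    rw [lintegral_prod_mul
      (f := fun v : Fin m → ℕ => s ^ v j) (g := fun v : Fin m → ℕ => s ^ v j)
      Measurable.of_discrete.aemeasurable Measurable.of_discrete.aemeasurable, ih, pow_one,
      mul_comm]

theorem isProbabilityMeasure_bind_nat {α : Type*} [MeasurableSpace α] (μ : Measure ℕ)
    [IsProbabilityMeasure μ] (κ : ℕ → Measure α) [∀ n, IsProbabilityMeasure (κ n)] :
    IsProbabilityMeasure (μ.bind κ) := by
  refine ⟨?_⟩
  rw [Measure.bind_apply .univ Measurable.of_discrete.aemeasurable]
  simp

theorem vecLaw_succ (k : ℕ) (δ z : ℝ) (m : ℕ) :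
    vecLaw k δ z (m + 1) =
      (natMeasure (tnbWeight (bcoef k δ (m + 1) / bcoef k δ m) (successProb k δ z m))).bind
        fun ℓ => (convPow (vecLaw k δ z m) ℓ).map fun v => Fin.snoc v ℓ := rfl

theorem isProbabilityMeasure_vecLaw {k : ℕ} {δ : ℝ} (hδ : -1 < δ) {z : ℝ} (hz : 1 < z) {m : ℕ}
    (hm : m ≤ k) : IsProbabilityMeasure (vecLaw k δ z m) := by
  induction m with
  | zero => unfold vecLaw; infer_instance
  | succ m ih =>
    have := ih (Nat.le_of_succ_le hm)
    have := isProbabilityMeasure_natMeasure_tnbWeight (bcoef_div_mem_Ioo hδ hm)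
      (successProb_mem_Ioo hδ hz (Nat.le_of_succ_le hm))
    have : ∀ ℓ, IsProbabilityMeasure ((convPow (vecLaw k δ z m) ℓ).map
        fun v => (Fin.snoc v ℓ : Fin (m + 1) → ℕ)) := fun ℓ =>
      Measure.isProbabilityMeasure_map Measurable.of_discrete.aemeasurable
    rw [vecLaw_succ]
    exact isProbabilityMeasure_bind_nat _ _

/-- The probability generating function of `N_j^{(m)}`. -/
def vecGen (k : ℕ) (δ z : ℝ) (m j : ℕ) (x : ℝ) : ℝ :=
  (1 - (1 - (1 - successProb k δ z j) * x) ^ (bcoef k δ m / bcoef k δ j))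
    / (1 - successProb k δ z m)

theorem vecGen_mem_Icc {k : ℕ} {δ : ℝ} (hδ : -1 < δ) {z : ℝ} (hz : 1 < z) {m j : ℕ}
    (hm : m ≤ k) (hj : j ≤ k) {x : ℝ} (hx : x ∈ Set.Icc (0 : ℝ) 1) :
    vecGen k δ z m j x ∈ Set.Icc (0 : ℝ) 1 := by
  obtain ⟨hq0, hq1⟩ := successProb_mem_Ioo hδ hz hj
  obtain ⟨hm0, hm1⟩ := successProb_mem_Ioo hδ hz hm
  obtain ⟨hx0, hx1⟩ := hx
  have hbm := bcoef_pos hδ hm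
  have hbj := bcoef_pos hδ hj
  have hle : successProb k δ z j ≤ 1 - (1 - successProb k δ z j) * x := by nlinarith
  have hle1 : 1 - (1 - successProb k δ z j) * x ≤ 1 := by nlinarith
  have h1 : successProb k δ z m
      ≤ (1 - (1 - successProb k δ z j) * x) ^ (bcoef k δ m / bcoef k δ j) := by
    refine le_trans (le_of_eq ?_) (Real.rpow_le_rpow hq0.le hle (by positivity))
    rw [successProb_rpow hδ hz hj, successProb]
  have h2 := Real.rpow_le_one (hq0.le.trans hle) hle1 (div_pos hbm hbj).le
  exact ⟨div_nonneg (by linarith) (by linarith), (div_le_one (by linarith)).2 (by linarith)⟩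

theorem one_sub_mul_vecGen {k : ℕ} {δ : ℝ} (hδ : -1 < δ) {z : ℝ} (hz : 1 < z) {m : ℕ}
    (hm : m ≤ k) (j : ℕ) (x : ℝ) :
    1 - (1 - successProb k δ z m) * vecGen k δ z m j x
      = (1 - (1 - successProb k δ z j) * x) ^ (bcoef k δ m / bcoef k δ j) := by
  have h : 1 - successProb k δ z m ≠ 0 := by linarith [(successProb_mem_Ioo hδ hz hm).2]
  rw [vecGen, mul_div_cancel₀ _ h]
  ring

theorem lintegral_pow_vecLaw {k : ℕ} {δ : ℝ} (hδ : -1 < δ) {z : ℝ} (hz : 1 < z) {m : ℕ}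
    (hm : m ≤ k) (j : Fin m) {x : ℝ} (hx : x ∈ Set.Icc (0 : ℝ) 1) :
    ∫⁻ v, ENNReal.ofReal x ^ v j ∂vecLaw k δ z m = ENNReal.ofReal (vecGen k δ z m j x) := by
  induction m with
  | zero => exact j.elim0
  | succ m ih =>
    have hm' := Nat.le_of_succ_le hm
    have := isProbabilityMeasure_vecLaw hδ hz hm'
    have hκ := bcoef_div_mem_Ioo hδ hm
    have hq := successProb_mem_Ioo hδ hz hm'
    have hgen : ∀ y ∈ Set.Icc (0 : ℝ) 1,
        ∫⁻ ℓ, ENNReal.ofReal y ^ ℓ ∂natMeasure (tnbWeight (bcoef k δ (m + 1) / bcoef k δ m)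
          (successProb k δ z m)) = ENNReal.ofReal (vecGen k δ z (m + 1) m y) := by
      intro y hy
      rw [lintegral_pow_natMeasure (tnbWeight_nonneg hκ hq) hy.1
        (hasSum_tnbWeight_mul_pow hκ hq hy), vecGen]
      have h := successProb_rpow hδ hz hm' (bcoef k δ (m + 1))
      rw [h, ← successProb]
    rw [vecLaw_succ, Measure.lintegral_bind Measurable.of_discrete.aemeasurable
      Measurable.of_discrete.aemeasurable]
    simp only [lintegral_map Measurable.of_discrete Measurable.of_discrete]
    induction j using Fin.lastCases with
    | last => simpa using hgen x hx
    | cast j =>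
      have hj : (j : ℕ) ≤ k := j.2.le.trans hm'
      simp only [Fin.snoc_castSucc, lintegral_pow_convPow, ih hm']
      rw [hgen _ (vecGen_mem_Icc hδ hz hm' hj hx)]
      congr 1
      have hbm := bcoef_pos hδ hm'
      have hbase : 0 ≤ 1 - (1 - successProb k δ z j) * x := by
        have := successProb_mem_Ioo hδ hz hj
        nlinarith [hx.1, hx.2, this.1, this.2]
      rw [vecGen, one_sub_mul_vecGen hδ hz hm', ← Real.rpow_mul hbase, vecGen, Fin.val_castSucc]
      congr 3
      field_simp

theorem pairLaw_eq_bind (k : ℕ) (δ z : ℝ) (m : ℕ) :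
    pairLaw k δ z m =
      (natMeasure (nbWeight ((1 + δ) / bcoef k δ m) (successProb k δ z m))).bind
        fun t => (convPow (vecLaw k δ z m) t).map fun v => (t, v) := rfl

theorem isProbabilityMeasure_pairLaw {k : ℕ} {δ : ℝ} (hδ : -1 < δ) {z : ℝ} (hz : 1 < z) {m : ℕ}
    (hm : m ≤ k) : IsProbabilityMeasure (pairLaw k δ z m) := by
  have := isProbabilityMeasure_vecLaw hδ hz hm
  have := isProbabilityMeasure_natMeasure_nbWeight
    (div_pos (by linarith : 0 < 1 + δ) (bcoef_pos hδ hm)) (successProb_mem_Ioo hδ hz hm)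
  have : ∀ t, IsProbabilityMeasure ((convPow (vecLaw k δ z m) t).map fun v => (t, v)) := fun t =>
    Measure.isProbabilityMeasure_map Measurable.of_discrete.aemeasurable
  rw [pairLaw_eq_bind]
  exact isProbabilityMeasure_bind_nat _ _

/-- The summand of the degree `D^{(i)}` contributed by the pair with index `m`. -/
def contribution (i m : ℕ) (y : ℕ × (Fin m → ℕ)) : ℕ :=
  if m = i then y.1 else if h : i < m then y.2 ⟨i, h⟩ else 0

theorem lintegral_pow_contribution {k : ℕ} {δ : ℝ} (hδ : -1 < δ) {z : ℝ} (hz : 1 < z) {m i : ℕ}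
    (hm : m ≤ k) {x : ℝ} (hx : x ∈ Set.Icc (0 : ℝ) 1) :
    ∫⁻ y, ENNReal.ofReal x ^ contribution i m y ∂pairLaw k δ z m =
      if i ≤ m then ENNReal.ofReal (z ^ (-((1 + δ) / bcoef k δ 0)) *
        (1 - (1 - successProb k δ z i) * x) ^ (-((1 + δ) / bcoef k δ i))) else 1 := by
  have := isProbabilityMeasure_pairLaw hδ hz hm
  have := isProbabilityMeasure_vecLaw hδ hz hm
  have hr := div_pos (by linarith : 0 < 1 + δ) (bcoef_pos hδ hm)
  have hq := successProb_mem_Ioo hδ hz hm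
  have hgen : ∀ y ∈ Set.Icc (0 : ℝ) 1,
      ∫⁻ t, ENNReal.ofReal y ^ t
        ∂natMeasure (nbWeight ((1 + δ) / bcoef k δ m) (successProb k δ z m)) =
      ENNReal.ofReal (z ^ (-((1 + δ) / bcoef k δ 0)) *
        (1 - (1 - successProb k δ z m) * y) ^ (-((1 + δ) / bcoef k δ m))) := by
    intro y hy
    rw [lintegral_pow_natMeasure (nbWeight_nonneg hr hq) hy.1 (hasSum_nbWeight_mul_pow hr hq hy),
      successProb_rpow hδ hz hm]
  rcases lt_trichotomy i m with h | rfl | h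
  · have hi : i ≤ k := h.le.trans hm
    rw [if_pos h.le, pairLaw_eq_bind, Measure.lintegral_bind Measurable.of_discrete.aemeasurable
      Measurable.of_discrete.aemeasurable]
    simp only [lintegral_map Measurable.of_discrete Measurable.of_discrete, contribution, h.ne',
      if_false, h, dif_pos, lintegral_pow_convPow, lintegral_pow_vecLaw hδ hz hm _ hx]
    rw [hgen _ (vecGen_mem_Icc hδ hz hm hi hx), one_sub_mul_vecGen hδ hz hm, ← Real.rpow_mul]
    · have hbm := bcoef_pos hδ hm
      congr 3
      field_simp
    · have := successProb_mem_Ioo hδ hz hi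
      nlinarith [hx.1, hx.2, this.1, this.2]
  · rw [if_pos le_rfl, pairLaw_eq_bind, Measure.lintegral_bind Measurable.of_discrete.aemeasurable
      Measurable.of_discrete.aemeasurable]
    simpa [lintegral_map Measurable.of_discrete Measurable.of_discrete, contribution] using hgen x hx
  · simp [contribution, h.ne, h.not_gt, h.not_ge]

theorem assembleD_eq_add_sum (k : ℕ) (x : ∀ m : Fin (k + 1), ℕ × (Fin (m : ℕ) → ℕ))
    (i : Fin (k + 1)) :
    assembleD k x i = k - (i : ℕ) + 1 + ∑ m : Fin (k + 1), contribution i m (x m) := by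
  have h : ∀ m : Fin (k + 1), contribution i m (x m) = (if m = i then (x m).1 else 0) +
      if h : (i : ℕ) < (m : ℕ) then (x m).2 ⟨(i : ℕ), h⟩ else 0 := by
    intro m
    unfold contribution
    by_cases hm : m = i
    · simp [hm]
    · simp [hm, Fin.val_inj]
  simp only [h, sum_add_distrib, sum_ite_eq', mem_univ, if_true]
  rw [assembleD, add_assoc]

theorem lintegral_pow_sum_contribution {k : ℕ} {δ : ℝ} (hδ : -1 < δ) {z : ℝ} (hz : 1 < z)
    (i : Fin (k + 1)) {x : ℝ} (hx : x ∈ Set.Icc (0 : ℝ) 1) :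
    ∫⁻ y, ENNReal.ofReal x ^ (∑ m : Fin (k + 1), contribution i m (y m)) ∂jointLaw k δ z =
      ENNReal.ofReal (z ^ (-((1 + δ) / bcoef k δ 0)) *
        (1 - (1 - successProb k δ z i) * x) ^ (-((1 + δ) / bcoef k δ i))) ^ (k + 1 - (i : ℕ)) := by
  have hP : ∀ m : Fin (k + 1), IsProbabilityMeasure (pairLaw k δ z m) := fun m =>
    isProbabilityMeasure_pairLaw hδ hz (Nat.le_of_lt_succ m.2)
  have hindep := ProbabilityTheory.iIndepFun_pi (μ := fun m : Fin (k + 1) => pairLaw k δ z m)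
    (X := fun m y => ENNReal.ofReal x ^ contribution i m y)
    fun m => Measurable.of_discrete.aemeasurable
  have hprod := ProbabilityTheory.lintegral_prod_eq_prod_lintegral_of_indepFun univ _ hindep
    fun m => Measurable.of_discrete
  simp only [← prod_pow_eq_pow_sum]
  rw [jointLaw, hprod]
  have hmarg : ∀ m : Fin (k + 1), ∫⁻ y, ENNReal.ofReal x ^ contribution i m (y m)
      ∂Measure.pi (fun m : Fin (k + 1) => pairLaw k δ z m) =
      ∫⁻ y, ENNReal.ofReal x ^ contribution i m y ∂pairLaw k δ z m := fun m =>
    (measurePreserving_eval (fun m : Fin (k + 1) => pairLaw k δ z m) m).lintegral_comp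
      (f := fun y => ENNReal.ofReal x ^ contribution i m y) Measurable.of_discrete
  simp only [hmarg]
  rw [prod_congr rfl fun m _ =>
    lintegral_pow_contribution (i := (i : ℕ)) hδ hz (Nat.le_of_lt_succ m.2) hx]
  rw [prod_ite, prod_const_one, mul_one, prod_const]
  congr 1
  have : univ.filter (fun m : Fin (k + 1) => (i : ℕ) ≤ m) = Ici i := by
    ext m
    simp only [mem_filter, mem_univ, true_and, mem_Ici, Fin.le_def]
  rw [this, Fin.card_Ici]

theorem shape_pos {k : ℕ} {δ : ℝ} (hδ : -1 < δ) {i : ℕ} (hi : i ≤ k) :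
    0 < ((k : ℝ) - i + 1) * (1 + δ) / bcoef k δ i := by
  have h1 : 0 < 1 + δ := by linarith
  have h2 : (i : ℝ) ≤ k := by exact_mod_cast hi
  have h3 : 0 < (k : ℝ) - i + 1 := by linarith
  have hb := bcoef_pos hδ hi
  positivity

theorem map_sum_contribution_jointLaw {k : ℕ} {δ : ℝ} (hδ : -1 < δ) {z : ℝ} (hz : 1 < z)
    (i : Fin (k + 1)) :
    (jointLaw k δ z).map (fun y => ∑ m : Fin (k + 1), contribution i m (y m)) =
      natMeasure (nbWeight (((k : ℝ) - (i : ℕ) + 1) * (1 + δ) / bcoef k δ i)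
        (successProb k δ z i)) := by
  have hik : (i : ℕ) ≤ k := Nat.le_of_lt_succ i.2
  have hq := successProb_mem_Ioo hδ hz hik
  have hcast : (k : ℝ) - (i : ℕ) + 1 = ((k + 1 - (i : ℕ) : ℕ) : ℝ) := by
    rw [Nat.cast_sub (by omega)]
    push_cast
    ring
  have hr := shape_pos hδ hik
  have hP : ∀ m : Fin (k + 1), IsProbabilityMeasure (pairLaw k δ z m) := fun m =>
    isProbabilityMeasure_pairLaw hδ hz (Nat.le_of_lt_succ m.2)
  have : IsProbabilityMeasure (jointLaw k δ z) := by
    unfold jointLaw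
    infer_instance
  have : IsProbabilityMeasure ((jointLaw k δ z).map fun y => ∑ m : Fin (k + 1), contribution i m (y m)) :=
    Measure.isProbabilityMeasure_map Measurable.of_discrete.aemeasurable
  have := isProbabilityMeasure_natMeasure_nbWeight hr hq
  refine measure_nat_ext_of_lintegral_pow fun x hx => ?_
  have hbase : 0 ≤ 1 - (1 - successProb k δ z i) * x := by nlinarith [hx.1, hx.2, hq.1, hq.2]
  have hz0 : 0 ≤ z := by linarith
  rw [lintegral_map .of_discrete .of_discrete, lintegral_pow_sum_contribution hδ hz i hx,
    lintegral_pow_natMeasure (nbWeight_nonneg hr hq) hx.1 (hasSum_nbWeight_mul_pow hr hq hx),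
    successProb_rpow hδ hz hik, ← ENNReal.ofReal_pow (by positivity), mul_pow,
    ← Real.rpow_mul_natCast hz0, ← Real.rpow_mul_natCast hbase, hcast]
  congr 3 <;> ring

theorem Dlaw_apply_toReal {k : ℕ} {δ : ℝ} (hδ : -1 < δ) {z : ℝ} (hz : 1 < z)
    (i : Fin (k + 1)) (ℓ : ℕ) :
    (Dlaw k δ z {v | v i = k - (i : ℕ) + 1 + ℓ}).toReal =
      nbWeight (((k : ℝ) - (i : ℕ) + 1) * (1 + δ) / bcoef k δ i) (successProb k δ z i) ℓ := by
  have hik : (i : ℕ) ≤ k := Nat.le_of_lt_succ i.2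
  have hset : assembleD k ⁻¹' {v | v i = k - (i : ℕ) + 1 + ℓ} =
      (fun y : ∀ m : Fin (k + 1), ℕ × (Fin (m : ℕ) → ℕ) =>
        ∑ m : Fin (k + 1), contribution i m (y m)) ⁻¹' {ℓ} := by
    ext y
    simp [assembleD_eq_add_sum]
  rw [Dlaw, Measure.map_apply .of_discrete .of_discrete, hset,
    ← Measure.map_apply .of_discrete .of_discrete, map_sum_contribution_jointLaw hδ hz,
    natMeasure_singleton,
    ENNReal.toReal_ofReal (nbWeight_nonneg (shape_pos hδ hik) (successProb_mem_Ioo hδ hz hik) ℓ)]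

/-- Marginally, the coordinate `i` of the limiting degree vector
`D^{(i)} = k-i+1 + T_i + Σ_{m=i+1}^k Σ_{j=1}^{T_m} N_{i,j}^{(m)}` (mixed over the
Pareto`(τ/b_0)` parameter `z`) has a mixed negative binomial law with shape
`(k-i+1)(1+δ)/b_i` and random success probability `Z^{-b_i/b_0}`. -/
theorem marginal_is_mixed_negative_binomial (k : ℕ) (δ : ℝ) (hδ : -1 < δ)
    (i : Fin (k + 1)) :
    ∀ ℓ : ℕ,
      (∫ z in Set.Ioi (1 : ℝ),
        (tauc k δ / bcoef k δ 0) * z ^ (-(1 + tauc k δ / bcoef k δ 0)) *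
          (Dlaw k δ z {v | v i = k - (i : ℕ) + 1 + ℓ}).toReal)
      = ∫ z in Set.Ioi (1 : ℝ),
          (tauc k δ / bcoef k δ 0) * z ^ (-(1 + tauc k δ / bcoef k δ 0)) *
            nbWeight (((k : ℝ) - (i : ℕ) + 1) * (1 + δ) / bcoef k δ i)
              (z ^ (-(bcoef k δ i / bcoef k δ 0))) ℓ := by
  intro ℓ
  refine setIntegral_congr_fun measurableSet_Ioi fun z hz => ?_
  simp only [Dlaw_apply_toReal hδ hz i ℓ, successProb]
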